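/- Let S₁ and S₂ be finite sets of n₁ and n₂ items. For each (i,j) ∈ S₁×S₂ let f_i : ℝ^{d₁} → ℝ be ρ_f-weakly-convex, C_f-Lipschitz continuous and non-decreasing; let g_i : ℝ^{d₂} → ℝ^{d₁} be ρ_g-weakly-convex and C_g-Lipschitz continuous; let h_{i,j} : ℝ^d → ℝ^{d₂} be C_h-Lipschitz continuous; and assume either (a) g_i is non-decreasing and h_{i,j} is L_h-weakly-convex, or (b) g_i is monotone and h_{i,j} is L_h-smooth. Then the tri-level objective F(w) = (1/n₁)·Σ_{i∈S₁} f_i((1/n₂)·Σ_{j∈S₂} g_i(h_{i,j}(w))) is ρ_F-weakly-convex with ρ_F = √d₁·(√d₂·L_h·C_g + ρ_g·C_h²)·C_f + ρ_f·C_g²·C_h². -/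

import Mathlib

noncomputable section

/-- A real-valued function on a real inner product space is `ρ`-weakly convex if
adding `ρ/2 ‖·‖²` makes it convex. -/
def WeaklyConvex {E : Type*} [NormedAddCommGroup E] [InnerProductSpace ℝ E]
    (ρ : ℝ) (f : E → ℝ) : Prop :=
  ConvexOn ℝ Set.univ fun x => f x + ρ / 2 * ‖x‖ ^ 2

/-- A vector-valued function is `ρ`-weakly convex if each component is. -/
def WeaklyConvexVec {E : Type*} [NormedAddCommGroup E] [InnerProductSpace ℝ E]
    {m : ℕ} (ρ : ℝ) (g : E → EuclideanSpace ℝ (Fin m)) : Prop :=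
  ∀ j : Fin m, WeaklyConvex ρ fun x => g x j

/-- `f` is `C`-Lipschitz continuous. -/
def LipschitzC {E F : Type*} [NormedAddCommGroup E] [NormedAddCommGroup F]
    (C : ℝ) (f : E → F) : Prop :=
  ∀ x y, ‖f x - f y‖ ≤ C * ‖x - y‖

/-- A scalar function on `ℝ^m` is non-decreasing with respect to each coordinate
of the input. -/
def CoordNonDecreasing {m : ℕ} (f : EuclideanSpace ℝ (Fin m) → ℝ) : Prop :=
  ∀ (k : Fin m) (x : EuclideanSpace ℝ (Fin m)),
    Monotone fun t : ℝ => f (x + t • EuclideanSpace.single k (1 : ℝ))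

/-- A scalar function on `ℝ^m` is monotone: with respect to each coordinate of the
input it is either non-decreasing or non-increasing. -/
def CoordMonotone {m : ℕ} (f : EuclideanSpace ℝ (Fin m) → ℝ) : Prop :=
  ∀ k : Fin m,
    (∀ x, Monotone fun t : ℝ => f (x + t • EuclideanSpace.single k (1 : ℝ))) ∨
    (∀ x, Antitone fun t : ℝ => f (x + t • EuclideanSpace.single k (1 : ℝ)))

/-- A vector-valued function is non-decreasing if each component is non-decreasing
with respect to each coordinate of the input. -/
def CoordNonDecreasingVec {m₁ m₂ : ℕ}
    (g : EuclideanSpace ℝ (Fin m₁) → EuclideanSpace ℝ (Fin m₂)) : Prop :=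
  ∀ j : Fin m₂, CoordNonDecreasing fun x => g x j

/-- A vector-valued function is monotone if each component is monotone. -/
def CoordMonotoneVec {m₁ m₂ : ℕ}
    (g : EuclideanSpace ℝ (Fin m₁) → EuclideanSpace ℝ (Fin m₂)) : Prop :=
  ∀ j : Fin m₂, CoordMonotone fun x => g x j

/-- `f` is `L`-smooth: differentiable with `L`-Lipschitz derivative. -/
def SmoothL {E F : Type*} [NormedAddCommGroup E] [NormedSpace ℝ E]
    [NormedAddCommGroup F] [NormedSpace ℝ F] (L : ℝ) (f : E → F) : Prop :=
  Differentiable ℝ f ∧ ∀ x y, ‖fderiv ℝ f x - fderiv ℝ f y‖ ≤ L * ‖x - y‖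

/-- `v` is a general subgradient of `f` at `x`:
`f y ≥ f x + ⟪v, y - x⟫ + o(‖y - x‖)` as `y → x`. -/
def IsSubgradient {E : Type*} [NormedAddCommGroup E] [InnerProductSpace ℝ E]
    (f : E → ℝ) (x v : E) : Prop :=
  ∀ ε > 0, ∃ δ > 0, ∀ y, ‖y - x‖ < δ →
    f x + @inner ℝ _ _ v (y - x) - ε * ‖y - x‖ ≤ f y

/-- Weak convexity as a perturbed Jensen inequality. -/
theorem weaklyConvex_iff {E : Type*} [NormedAddCommGroup E] [InnerProductSpace ℝ E]
    {ρ : ℝ} {f : E → ℝ} :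
    WeaklyConvex ρ f ↔ ∀ x y : E, ∀ a b : ℝ, 0 ≤ a → 0 ≤ b → a + b = 1 →
      f (a • x + b • y) ≤ a * f x + b * f y + ρ / 2 * (a * b * ‖x - y‖ ^ 2) := by
  have key : ∀ x y : E, ∀ a b : ℝ, a + b = 1 →
      ‖a • x + b • y‖ ^ 2 = a * ‖x‖ ^ 2 + b * ‖y‖ ^ 2 - a * b * ‖x - y‖ ^ 2 := by
    intro x y a b hab
    obtain rfl : b = 1 - a := by linarith
    rw [norm_add_sq_real, norm_sub_sq_real, norm_smul, norm_smul, mul_pow, mul_pow,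
      Real.norm_eq_abs, Real.norm_eq_abs, sq_abs, sq_abs, real_inner_smul_left,
      real_inner_smul_right]
    ring
  constructor
  · intro hf x y a b ha hb hab
    have := hf.2 (Set.mem_univ x) (Set.mem_univ y) ha hb hab
    simp only [smul_eq_mul, key x y a b hab] at this
    linarith
  · intro hf
    refine ⟨convex_univ, fun x _ y _ a b ha hb hab => ?_⟩
    have := hf x y a b ha hb hab
    simp only [smul_eq_mul, key x y a b hab]
    linarith

/-- An average of weakly convex functions is weakly convex with the same modulus. -/
theorem WeaklyConvex.average {E : Type*} [NormedAddCommGroup E] [InnerProductSpace ℝ E]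
    {n : ℕ} (hn : 0 < n) {ρ : ℝ} {f : Fin n → E → ℝ} (hf : ∀ i, WeaklyConvex ρ (f i)) :
    WeaklyConvex ρ fun x => (n : ℝ)⁻¹ * ∑ i, f i x := by
  rw [weaklyConvex_iff]
  intro x y a b ha hb hab
  have hn' : (0 : ℝ) < n := by exact_mod_cast hn
  have hsum := Finset.sum_le_sum fun i (_ : i ∈ Finset.univ) =>
    weaklyConvex_iff.1 (hf i) x y a b ha hb hab
  simp only [Finset.sum_add_distrib, ← Finset.mul_sum, Finset.sum_const, Finset.card_univ,
    Fintype.card_fin, nsmul_eq_mul] at hsum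
  calc (n : ℝ)⁻¹ * ∑ i, f i (a • x + b • y)
      ≤ (n : ℝ)⁻¹ * (a * ∑ i, f i x + b * ∑ i, f i y
          + n * (ρ / 2 * (a * b * ‖x - y‖ ^ 2))) := by
        gcongr
        linarith
    _ = _ := by field_simp

/-- An average of Lipschitz functions is Lipschitz with the same constant. -/
theorem LipschitzC.average {E F : Type*} [NormedAddCommGroup E] [NormedAddCommGroup F]
    [NormedSpace ℝ F] {n : ℕ} (hn : 0 < n) {C : ℝ} {f : Fin n → E → F}
    (hf : ∀ i, LipschitzC C (f i)) :
    LipschitzC C fun x => (n : ℝ)⁻¹ • ∑ i, f i x := by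
  intro x y
  have hn' : (0 : ℝ) < n := by exact_mod_cast hn
  have hsum : ‖∑ i, (f i x - f i y)‖ ≤ n * (C * ‖x - y‖) := by
    refine (norm_sum_le_of_le _ fun i _ => hf i x y).trans_eq ?_
    simp
  rw [← smul_sub, ← Finset.sum_sub_distrib, norm_smul, norm_inv, Real.norm_natCast]
  calc (n : ℝ)⁻¹ * ‖∑ i, (f i x - f i y)‖ ≤ (n : ℝ)⁻¹ * (n * (C * ‖x - y‖)) := by gcongr
    _ = _ := by field_simp

theorem LipschitzC.comp {E F G : Type*} [NormedAddCommGroup E] [NormedAddCommGroup F]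
    [NormedAddCommGroup G] {C K : ℝ} (hC : 0 ≤ C) {f : F → G} {g : E → F}
    (hf : LipschitzC C f) (hg : LipschitzC K g) : LipschitzC (C * K) fun x => f (g x) := by
  intro x y
  calc ‖f (g x) - f (g y)‖ ≤ C * ‖g x - g y‖ := hf _ _
    _ ≤ C * (K * ‖x - y‖) := by gcongr; exact hg x y
    _ = _ := by ring

theorem LipschitzC.apply {E : Type*} [NormedAddCommGroup E] {m : ℕ} {C : ℝ}
    {g : E → EuclideanSpace ℝ (Fin m)} (hg : LipschitzC C g) (k : Fin m) :
    LipschitzC C fun x => g x k := fun x y =>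
  (PiLp.norm_apply_le (g x - g y) k).trans (hg x y)

/-- A coordinatewise non-decreasing function is monotone for the coordinatewise order. -/
theorem CoordNonDecreasing.le {m : ℕ} {f : EuclideanSpace ℝ (Fin m) → ℝ}
    (hf : CoordNonDecreasing f) {x y : EuclideanSpace ℝ (Fin m)} (hxy : ∀ k, x k ≤ y k) :
    f x ≤ f y := by
  have step : ∀ s : Finset (Fin m),
      f x ≤ f (x + ∑ k ∈ s, (y k - x k) • EuclideanSpace.single k (1 : ℝ)) := by
    intro s
    induction s using Finset.induction_on with
    | empty => simp
    | insert k s hk ih =>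
      refine ih.trans ?_
      have := hf k (x + ∑ k ∈ s, (y k - x k) • EuclideanSpace.single k (1 : ℝ))
        (sub_nonneg.2 (hxy k))
      simp only [zero_smul, add_zero] at this
      rwa [Finset.sum_insert hk, add_comm (_ • _), ← add_assoc]
  convert step Finset.univ using 2
  ext l
  simp [Finset.sum_apply, Pi.single_apply]

theorem EuclideanSpace.norm_le_sqrt_mul {m : ℕ} {B : ℝ} (hB : 0 ≤ B)
    {v : EuclideanSpace ℝ (Fin m)} (hv : ∀ k, |v k| ≤ B) : ‖v‖ ≤ Real.sqrt m * B := by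
  rw [EuclideanSpace.norm_eq]
  refine Real.sqrt_le_iff.2 ⟨by positivity, ?_⟩
  rw [mul_pow, Real.sq_sqrt (Nat.cast_nonneg m)]
  calc ∑ k, ‖v k‖ ^ 2 ≤ ∑ _k : Fin m, B ^ 2 := by
        gcongr with k
        exact hv k
    _ = m * B ^ 2 := by simp

/-- A `C`-Lipschitz function grows by at most `C √m B` when each coordinate moves by at
most `B`. -/
theorem LipschitzC.le_add_of_abs_le {m : ℕ} {C B : ℝ} (hC : 0 ≤ C) (hB : 0 ≤ B)
    {f : EuclideanSpace ℝ (Fin m) → ℝ} (hf : LipschitzC C f)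
    {x y : EuclideanSpace ℝ (Fin m)} (hxy : ∀ k, |x k - y k| ≤ B) :
    f x ≤ f y + C * (Real.sqrt m * B) := by
  have h₁ := (Real.le_norm_self _).trans (hf x y)
  have h₂ : ‖x - y‖ ≤ Real.sqrt m * B := EuclideanSpace.norm_le_sqrt_mul hB hxy
  have h₃ := mul_le_mul_of_nonneg_left h₂ hC
  linarith

/-- For a non-decreasing Lipschitz function, an upper bound on the coordinates suffices. -/
theorem LipschitzC.le_add_of_le {m : ℕ} {C B : ℝ} (hC : 0 ≤ C) (hB : 0 ≤ B)
    {f : EuclideanSpace ℝ (Fin m) → ℝ} (hf : LipschitzC C f) (hmono : CoordNonDecreasing f)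
    {x y : EuclideanSpace ℝ (Fin m)} (hxy : ∀ k, x k ≤ y k + B) :
    f x ≤ f y + C * (Real.sqrt m * B) := by
  let z : EuclideanSpace ℝ (Fin m) := WithLp.toLp 2 fun k => y k + B
  have hxz : f x ≤ f z := hmono.le hxy
  refine hxz.trans (hf.le_add_of_abs_le hC hB fun k => ?_)
  simp [z, abs_of_nonneg hB]

/-- Composition rule for weak convexity, given a bound on the outer function along the
Jensen gap of the inner one. -/
theorem WeaklyConvex.comp_of_le {E : Type*} [NormedAddCommGroup E] [InnerProductSpace ℝ E]
    {m : ℕ} {ρ σ C K : ℝ} (hρ : 0 ≤ ρ)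
    {f : EuclideanSpace ℝ (Fin m) → ℝ} {g : E → EuclideanSpace ℝ (Fin m)}
    (hf : WeaklyConvex ρ f) (hg : LipschitzC K g)
    (hfg : ∀ x y : E, ∀ a b : ℝ, 0 ≤ a → 0 ≤ b → a + b = 1 →
      f (g (a • x + b • y)) ≤ f (a • g x + b • g y)
        + C * (Real.sqrt m * (σ / 2 * (a * b * ‖x - y‖ ^ 2)))) :
    WeaklyConvex (Real.sqrt m * σ * C + ρ * K ^ 2) fun x => f (g x) := by
  rw [weaklyConvex_iff]
  intro x y a b ha hb hab
  have h₁ := hfg x y a b ha hb hab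
  have h₂ := weaklyConvex_iff.1 hf (g x) (g y) a b ha hb hab
  have h₃ : ρ / 2 * (a * b * ‖g x - g y‖ ^ 2) ≤ ρ / 2 * (a * b * (K * ‖x - y‖) ^ 2) := by
    gcongr
    exact hg x y
  linarith

/-- A non-decreasing weakly convex Lipschitz function of a weakly convex Lipschitz map is
weakly convex. -/
theorem WeaklyConvex.comp_of_coordNonDecreasing {E : Type*} [NormedAddCommGroup E]
    [InnerProductSpace ℝ E] {m : ℕ} {ρ σ C K : ℝ} (hρ : 0 ≤ ρ) (hσ : 0 ≤ σ) (hC : 0 ≤ C)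
    {f : EuclideanSpace ℝ (Fin m) → ℝ} {g : E → EuclideanSpace ℝ (Fin m)}
    (hf : WeaklyConvex ρ f) (hfC : LipschitzC C f) (hmono : CoordNonDecreasing f)
    (hg : WeaklyConvexVec σ g) (hgK : LipschitzC K g) :
    WeaklyConvex (Real.sqrt m * σ * C + ρ * K ^ 2) fun x => f (g x) := by
  refine hf.comp_of_le hρ hgK fun x y a b ha hb hab => ?_
  refine hfC.le_add_of_le hC (by positivity) hmono fun k => ?_
  simpa using weaklyConvex_iff.1 (hg k) x y a b ha hb hab

/-- Quadratic bound on the first-order Taylor remainder of a smooth map. -/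
theorem SmoothL.norm_taylor_le {E F : Type*} [NormedAddCommGroup E] [NormedSpace ℝ E]
    [NormedAddCommGroup F] [NormedSpace ℝ F] {L : ℝ} {f : E → F} (hf : SmoothL L f) (z v : E) :
    ‖f (z + v) - f z - fderiv ℝ f z v‖ ≤ L / 2 * ‖v‖ ^ 2 := by
  let φ : ℝ → F := fun t => f (z + t • v) - f z - t • fderiv ℝ f z v
  have hφ : ∀ t, HasDerivAt φ (fderiv ℝ f (z + t • v) v - fderiv ℝ f z v) t := by
    intro t
    have hline : HasDerivAt (fun t : ℝ => z + t • v) v t := by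
      simpa using ((hasDerivAt_id t).smul_const v).const_add z
    have hlin : HasDerivAt (fun t : ℝ => t • fderiv ℝ f z v) (fderiv ℝ f z v) t := by
      simpa using (hasDerivAt_id t).smul_const (fderiv ℝ f z v)
    exact (((hf.1 _).hasFDerivAt.comp_hasDerivAt t hline).sub_const _).sub hlin
  have hB : ∀ t : ℝ, HasDerivAt (fun t : ℝ => L / 2 * ‖v‖ ^ 2 * t ^ 2) (L * ‖v‖ ^ 2 * t) t := by
    intro t
    refine ((hasDerivAt_pow 2 t).const_mul (L / 2 * ‖v‖ ^ 2)).congr_deriv ?_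
    norm_num
    ring
  have hbound : ∀ t ∈ Set.Ico (0 : ℝ) 1,
      ‖fderiv ℝ f (z + t • v) v - fderiv ℝ f z v‖ ≤ L * ‖v‖ ^ 2 * t := by
    intro t ht
    have h₁ := (fderiv ℝ f (z + t • v) - fderiv ℝ f z).le_of_opNorm_le (hf.2 (z + t • v) z) v
    rw [add_sub_cancel_left, norm_smul, Real.norm_of_nonneg ht.1] at h₁
    calc _ ≤ L * (t * ‖v‖) * ‖v‖ := h₁
      _ = _ := by ring
  have := image_norm_le_of_norm_deriv_right_le_deriv_boundary (a := 0) (b := 1) (f := φ)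
    (fun t _ => (hφ t).continuousAt.continuousWithinAt) (fun t _ => (hφ t).hasDerivWithinAt)
    (by simp [φ]) hB hbound (Set.right_mem_Icc.2 zero_le_one)
  simpa [φ] using this

/-- The Jensen gap of a smooth map is quadratically small. -/
theorem SmoothL.norm_jensen_gap_le {E F : Type*} [NormedAddCommGroup E] [NormedSpace ℝ E]
    [NormedAddCommGroup F] [NormedSpace ℝ F] {L : ℝ} {f : E → F} (hf : SmoothL L f)
    (x y : E) {a b : ℝ} (ha : 0 ≤ a) (hb : 0 ≤ b) (hab : a + b = 1) :
    ‖f (a • x + b • y) - (a • f x + b • f y)‖ ≤ L / 2 * (a * b * ‖x - y‖ ^ 2) := by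
  have hb' : b = 1 - a := eq_sub_of_add_eq' hab
  set z := a • x + b • y with hz
  have hx : z + b • (x - y) = x := by
    rw [hz, hb']; module
  have hy : z + (-a) • (x - y) = y := by
    rw [hz, hb']; module
  have h₁ := hf.norm_taylor_le z (b • (x - y))
  have h₂ := hf.norm_taylor_le z ((-a) • (x - y))
  rw [hx, norm_smul, Real.norm_of_nonneg hb] at h₁
  rw [hy, norm_smul, norm_neg, Real.norm_of_nonneg ha] at h₂
  have hsplit : f z - (a • f x + b • f y) =
      -(a • (f x - f z - fderiv ℝ f z (b • (x - y)))
        + b • (f y - f z - fderiv ℝ f z ((-a) • (x - y)))) := by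
    rw [map_smul, map_smul, hb']; module
  rw [hsplit, norm_neg]
  refine (norm_add_le _ _).trans ?_
  rw [norm_smul, norm_smul, Real.norm_of_nonneg ha, Real.norm_of_nonneg hb]
  calc _ ≤ a * (L / 2 * (b * ‖x - y‖) ^ 2) + b * (L / 2 * (a * ‖x - y‖) ^ 2) := by gcongr
    _ = (a + b) * (L / 2 * (a * b * ‖x - y‖ ^ 2)) := by ring
    _ = _ := by rw [hab, one_mul]

/-- A weakly convex Lipschitz function of a smooth Lipschitz map is weakly convex. -/
theorem WeaklyConvex.comp_of_smoothL {E : Type*} [NormedAddCommGroup E]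
    [InnerProductSpace ℝ E] {m : ℕ} {ρ L C K : ℝ} (hρ : 0 ≤ ρ) (hL : 0 ≤ L) (hC : 0 ≤ C)
    {f : EuclideanSpace ℝ (Fin m) → ℝ} {g : E → EuclideanSpace ℝ (Fin m)}
    (hf : WeaklyConvex ρ f) (hfC : LipschitzC C f) (hg : SmoothL L g) (hgK : LipschitzC K g) :
    WeaklyConvex (Real.sqrt m * L * C + ρ * K ^ 2) fun x => f (g x) := by
  refine hf.comp_of_le hρ hgK fun x y a b ha hb hab => ?_
  refine hfC.le_add_of_abs_le hC (by positivity) fun k => ?_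
  exact (PiLp.norm_apply_le (g (a • x + b • y) - (a • g x + b • g y)) k).trans
    (hg.norm_jensen_gap_le x y ha hb hab)

/-- Proposition 2. Under Assumption 2, the tri-level objective
`F(w) = (1/n₁) Σ_i f_i((1/n₂) Σ_j g_i(h_{i,j}(w)))` is `ρ_F`-weakly convex with
`ρ_F = √d₁ (√d₂ L_h C_g + ρ_g C_h²) C_f + ρ_f C_g² C_h²`. -/
theorem tcco_objective_weakly_convex
    (d d₁ d₂ n₁ n₂ : ℕ) (hn₁ : 0 < n₁) (hn₂ : 0 < n₂)
    (ρf ρg Cf Cg Ch Lh : ℝ)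
    (hρf : 0 ≤ ρf) (hρg : 0 ≤ ρg) (hCf : 0 ≤ Cf) (hCg : 0 ≤ Cg) (hCh : 0 ≤ Ch)
    (hLh : 0 ≤ Lh)
    (f : Fin n₁ → EuclideanSpace ℝ (Fin d₁) → ℝ)
    (g : Fin n₁ → EuclideanSpace ℝ (Fin d₂) → EuclideanSpace ℝ (Fin d₁))
    (h : Fin n₁ → Fin n₂ → EuclideanSpace ℝ (Fin d) → EuclideanSpace ℝ (Fin d₂))
    (hfwc : ∀ i, WeaklyConvex ρf (f i))
    (hflip : ∀ i, LipschitzC Cf (f i))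
    (hfmono : ∀ i, CoordNonDecreasing (f i))
    (hgwc : ∀ i, WeaklyConvexVec ρg (g i))
    (hglip : ∀ i, LipschitzC Cg (g i))
    (hhlip : ∀ i j, LipschitzC Ch (h i j))
    (hcase :
      ((∀ i, CoordNonDecreasingVec (g i)) ∧ ∀ i j, WeaklyConvexVec Lh (h i j)) ∨
      ((∀ i, CoordMonotoneVec (g i)) ∧ ∀ i j, SmoothL Lh (h i j))) :
    WeaklyConvex
      (Real.sqrt d₁ * (Real.sqrt d₂ * Lh * Cg + ρg * Ch ^ 2) * Cf + ρf * Cg ^ 2 * Ch ^ 2)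
      (fun w => (n₁ : ℝ)⁻¹ * ∑ i, f i ((n₂ : ℝ)⁻¹ • ∑ j, g i (h i j w))) := by
  have hinner : ∀ i j k, WeaklyConvex (Real.sqrt d₂ * Lh * Cg + ρg * Ch ^ 2)
      fun w => g i (h i j w) k := by
    intro i j k
    rcases hcase with ⟨hgmono, hhwc⟩ | ⟨-, hhsmooth⟩
    · exact (hgwc i k).comp_of_coordNonDecreasing hρg hLh hCg ((hglip i).apply k) (hgmono i k)
        (hhwc i j) (hhlip i j)
    · exact (hgwc i k).comp_of_smoothL hρg hLh hCg ((hglip i).apply k) (hhsmooth i j) (hhlip i j)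
  refine WeaklyConvex.average hn₁ fun i => ?_
  rw [mul_assoc ρf, ← mul_pow]
  refine (hfwc i).comp_of_coordNonDecreasing hρf (by positivity) hCf (hflip i) (hfmono i)
    (fun k => ?_) (LipschitzC.average hn₂ fun j => (hglip i).comp hCg (hhlip i j))
  simpa using WeaklyConvex.average hn₂ fun j => hinner i j k
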